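/- Let C ⊆ ℝ be bounded, closed, infinite, and nowhere dense, and let D be the set of lengths of the bounded connected components of ℝ∖C. Then D ⊆ (0,∞), D is bounded, every point of D is isolated in D (D is discrete), 0 is a limit point of D, and the closure of D in ℝ equals D ∪ {0}. -/

import Mathlib

open Set

/-- For a closed set `C ⊆ ℝ`, `Ioo u v` is a bounded connected component of `ℝ \ C`
(a bounded complementary interval of `C`) iff `u < v`, `Ioo u v` misses `C`, and
both endpoints belong to `C`. -/
def IsBddCompInterval (C : Set ℝ) (u v : ℝ) : Prop :=
  u < v ∧ Ioo u v ∩ C = ∅ ∧ u ∈ C ∧ v ∈ C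

lemma IsBddCompInterval.le_left_of_lt_right {C : Set ℝ} {u v u' : ℝ}
    (h : IsBddCompInterval C u v) (hu' : u' ∈ C) (hlt : u' < v) : u' ≤ u := by
  by_contra! hu
  exact (h.2.1.subset ⟨⟨hu, hlt⟩, hu'⟩ : u' ∈ (∅ : Set ℝ))

/-- The right endpoint of a complementary interval is determined by the left one. -/
lemma IsBddCompInterval.right_unique {C : Set ℝ} {u v v' : ℝ}
    (h : IsBddCompInterval C u v) (h' : IsBddCompInterval C u v') : v = v' := by
  rcases lt_trichotomy v v' with hlt | heq | hlt
  · exact absurd (h'.le_left_of_lt_right h.2.2.2 hlt) (not_le.2 h.1)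
  · exact heq
  · exact absurd (h.le_left_of_lt_right h'.2.2.2 hlt) (not_le.2 h'.1)

/-- On a bounded set of reals, `x ↦ ⌊x / δ⌋` takes finitely many values. -/
lemma exists_mapsTo_floor_div_Icc {C : Set ℝ} (hC : Bornology.IsBounded C) {δ : ℝ} (hδ : 0 < δ) :
    ∃ m n : ℤ, MapsTo (fun x : ℝ => ⌊x / δ⌋) C (Icc m n) := by
  obtain ⟨a, ha⟩ := hC.bddBelow
  obtain ⟨b, hb⟩ := hC.bddAbove
  exact ⟨⌊a / δ⌋, ⌊b / δ⌋, fun x hx =>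
    ⟨Int.floor_le_floor (div_le_div_of_nonneg_right (ha hx) hδ.le),
      Int.floor_le_floor (div_le_div_of_nonneg_right (hb hx) hδ.le)⟩⟩

lemma abs_sub_lt_of_floor_div_eq {x y δ : ℝ} (hδ : 0 < δ) (h : ⌊x / δ⌋ = ⌊y / δ⌋) :
    |x - y| < δ := by
  have h1 := Int.abs_sub_lt_one_of_floor_eq_floor h
  rwa [← sub_div, abs_div, abs_of_pos hδ, div_lt_one hδ] at h1

/-- A bounded set has only finitely many complementary intervals of length at least `δ > 0`. -/
lemma finite_isBddCompInterval_of_le {C : Set ℝ} (hC : Bornology.IsBounded C) {δ : ℝ}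
    (hδ : 0 < δ) : {p : ℝ × ℝ | IsBddCompInterval C p.1 p.2 ∧ δ ≤ p.2 - p.1}.Finite := by
  obtain ⟨m, n, hmn⟩ := exists_mapsTo_floor_div_Icc hC hδ
  refine Set.Finite.of_injOn (f := fun p : ℝ × ℝ => ⌊p.1 / δ⌋) (t := Icc m n)
    (fun p hp => hmn hp.1.2.2.1) ?_ (finite_Icc m n)
  rintro ⟨u, v⟩ ⟨h, hl⟩ ⟨u', v'⟩ ⟨h', hl'⟩ heq
  dsimp only at h hl h' hl' heq
  have hlt := abs_lt.1 (abs_sub_lt_of_floor_div_eq hδ heq)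
  have huu : u = u' := le_antisymm
    (h'.le_left_of_lt_right h.2.2.1 (by linarith)) (h.le_left_of_lt_right h'.2.2.1 (by linarith))
  subst huu
  rw [h.right_unique h']

lemma finite_setOf_length_inter_Ici {C : Set ℝ} (hC : Bornology.IsBounded C) {δ : ℝ}
    (hδ : 0 < δ) : ({x | ∃ u v : ℝ, IsBddCompInterval C u v ∧ x = v - u} ∩ Ici δ).Finite := by
  refine ((finite_isBddCompInterval_of_le hC hδ).image fun p => p.2 - p.1).subset ?_
  rintro x ⟨⟨u, v, h, rfl⟩, hx⟩
  exact ⟨(u, v), ⟨h, hx⟩, rfl⟩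

/-- A point outside a closed set but between two of its points lies in a complementary interval. -/
lemma exists_isBddCompInterval_of_notMem {C : Set ℝ} (hC : IsClosed C) {a b w : ℝ}
    (ha : a ∈ C) (hb : b ∈ C) (haw : a ≤ w) (hwb : w ≤ b) (hw : w ∉ C) :
    ∃ u v, IsBddCompInterval C u v ∧ a ≤ u ∧ v ≤ b := by
  have bL : BddAbove (C ∩ Iic w) := ⟨w, fun x hx => hx.2⟩
  have bR : BddBelow (C ∩ Ici w) := ⟨w, fun x hx => hx.2⟩
  have hL := (hC.inter isClosed_Iic).csSup_mem ⟨a, ha, haw⟩ bL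
  have hR := (hC.inter isClosed_Ici).csInf_mem ⟨b, hb, hwb⟩ bR
  have hLw : sSup (C ∩ Iic w) < w := lt_of_le_of_ne hL.2 fun h => hw (h ▸ hL.1)
  refine ⟨sSup (C ∩ Iic w), sInf (C ∩ Ici w), ⟨hLw.trans_le hR.2, ?_, hL.1, hR.1⟩,
    le_csSup bL ⟨ha, haw⟩, csInf_le bR ⟨hb, hwb⟩⟩
  rw [eq_empty_iff_forall_notMem]
  rintro x ⟨⟨h1, h2⟩, hx⟩
  rcases le_total x w with h | h
  · exact h1.not_ge (le_csSup bL ⟨hx, h⟩)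
  · exact h2.not_ge (csInf_le bR ⟨hx, h⟩)

/-- A bounded infinite set contains two distinct points at distance less than `ε`. -/
lemma Set.Infinite.exists_lt_sub_lt {C : Set ℝ} (hinf : C.Infinite) (hC : Bornology.IsBounded C)
    {ε : ℝ} (hε : 0 < ε) : ∃ a ∈ C, ∃ b ∈ C, a < b ∧ b - a < ε := by
  obtain ⟨m, n, hmn⟩ := exists_mapsTo_floor_div_Icc hC hε
  obtain ⟨x, hx, y, hy, hne, heq⟩ := hinf.exists_ne_map_eq_of_mapsTo hmn (finite_Icc m n)
  have h := abs_lt.1 (abs_sub_lt_of_floor_div_eq hε heq)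
  rcases hne.lt_or_gt with hlt | hlt
  · exact ⟨x, hx, y, hy, hlt, by linarith⟩
  · exact ⟨y, hy, x, hx, hlt, by linarith⟩

lemma exists_isBddCompInterval_sub_lt {C : Set ℝ} (hbdd : Bornology.IsBounded C)
    (hcl : IsClosed C) (hinf : C.Infinite) (hint : interior C = ∅) {ε : ℝ} (hε : 0 < ε) :
    ∃ u v, IsBddCompInterval C u v ∧ v - u < ε := by
  obtain ⟨a, ha, b, hb, hab, hlt⟩ := hinf.exists_lt_sub_lt hbdd hε
  obtain ⟨w, ⟨haw, hwb⟩, hw⟩ : ∃ w ∈ Ioo a b, w ∉ C := by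
    by_contra! h
    have hsub : Ioo a b ⊆ interior C := interior_maximal h isOpen_Ioo
    rw [hint] at hsub
    exact (nonempty_Ioo.2 hab).ne_empty (subset_empty_iff.1 hsub)
  obtain ⟨u, v, h, hau, hvb⟩ := exists_isBddCompInterval_of_notMem hcl ha hb haw.le hwb.le hw
  exact ⟨u, v, h, by linarith⟩

theorem stmt11 (C : Set ℝ)
    (hbdd : Bornology.IsBounded C) (hcl : IsClosed C) (hinf : C.Infinite)
    (hnd : interior (closure C) = ∅) :
    {x | ∃ u v : ℝ, IsBddCompInterval C u v ∧ x = v - u} ⊆ Ioi (0:ℝ) ∧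
    Bornology.IsBounded {x | ∃ u v : ℝ, IsBddCompInterval C u v ∧ x = v - u} ∧
    (∀ x ∈ {x | ∃ u v : ℝ, IsBddCompInterval C u v ∧ x = v - u},
      ∃ ε > 0, ∀ y ∈ {x | ∃ u v : ℝ, IsBddCompInterval C u v ∧ x = v - u},
        |y - x| < ε → y = x) ∧
    (∀ ε > 0, ∃ x ∈ {x | ∃ u v : ℝ, IsBddCompInterval C u v ∧ x = v - u}, x < ε) ∧
    closure {x | ∃ u v : ℝ, IsBddCompInterval C u v ∧ x = v - u}
      = {x | ∃ u v : ℝ, IsBddCompInterval C u v ∧ x = v - u} ∪ {0} := by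
  set D : Set ℝ := {x | ∃ u v : ℝ, IsBddCompInterval C u v ∧ x = v - u} with hD
  have hpos : D ⊆ Ioi (0 : ℝ) := by
    rintro x ⟨u, v, h, rfl⟩
    exact sub_pos.2 h.1
  have hsmall : ∀ ε > 0, ∃ x ∈ D, x < ε := fun ε hε => by
    obtain ⟨u, v, h, hlt⟩ :=
      exists_isBddCompInterval_sub_lt hbdd hcl hinf (hcl.closure_eq ▸ hnd) hε
    exact ⟨v - u, ⟨u, v, h, rfl⟩, hlt⟩
  refine ⟨hpos, ?_, ?_, hsmall, ?_⟩
  · obtain ⟨a, ha⟩ := hbdd.bddBelow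
    obtain ⟨b, hb⟩ := hbdd.bddAbove
    refine (Metric.isBounded_Icc 0 (b - a)).subset ?_
    rintro x ⟨u, v, h, rfl⟩
    exact ⟨sub_nonneg.2 h.1.le, sub_le_sub (hb h.2.2.2) (ha h.2.2.1)⟩
  · intro x hx
    have hx0 : 0 < x := hpos hx
    have hfin : ((D ∩ Ici (x / 2)) \ {x}).Finite :=
      (finite_setOf_length_inter_Ici hbdd (half_pos hx0)).subset sdiff_subset
    obtain ⟨ε, hε, hball⟩ := Metric.isOpen_iff.1 hfin.isClosed.isOpen_compl x
      (fun h => h.2 rfl)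
    refine ⟨min ε (x / 2), lt_min hε (half_pos hx0), fun y hy hyx => ?_⟩
    by_contra hne
    refine hball (Metric.mem_ball.2 (hyx.trans_le (min_le_left _ _))) ⟨⟨hy, ?_⟩, hne⟩
    have := (abs_lt.1 (hyx.trans_le (min_le_right _ _))).1
    exact mem_Ici.2 (by linarith)
  · apply Subset.antisymm
    · intro x hx
      have hx0 : 0 ≤ x := closure_minimal (hpos.trans Ioi_subset_Ici_self) isClosed_Ici hx
      rcases hx0.eq_or_lt with rfl | hx0
      · exact Or.inr rfl
      · have hfin := finite_setOf_length_inter_Ici hbdd (half_pos hx0)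
        have hmem : x ∈ closure (D ∩ Ici (x / 2)) :=
          closure_mono (inter_subset_inter_right D Ioi_subset_Ici_self)
            (isOpen_Ioi.closure_inter ⟨hx, half_lt_self hx0⟩)
        rw [hfin.isClosed.closure_eq] at hmem
        exact Or.inl hmem.1
    · refine union_subset subset_closure (singleton_subset_iff.2 (Metric.mem_closure_iff.2 ?_))
      intro ε hε
      obtain ⟨x, hx, hlt⟩ := hsmall ε hε
      refine ⟨x, hx, ?_⟩
      rwa [dist_comm, Real.dist_0_eq_abs, abs_of_pos (hpos hx)]
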